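/- arXiv:2104.09170 — 3 statements merged into one kernel-verified Lean document; each statement's English description precedes it below -/
import Mathlib

section
/- Let γ ∈ (−2,0), s > 2, ε > 0, and let f : ℝ³ → ℝ be measurable with 0 ≤ f ≤ ε⁻¹, ∫ f(v)⟨v⟩^{γ+2} dv < ∞, and ∫ f(v)⟨v⟩^{s+γ} dv < ∞. Then εs ∬_{ℝ³×ℝ³} f(v)² f(v₊) |v−v₊|^{γ+2} (⟨v⟩^{s−2} − ⟨v₊⟩^{s−2}) dv dv₊ ≤ 2sε (∫_{ℝ³} f(v₊)⟨v₊⟩^{γ+2} dv₊) (∫_{ℝ³} f(v)² ⟨v⟩^{γ+s} dv) ≤ 2s (∫_{ℝ³} f(v₊)⟨v₊⟩^{γ+2} dv₊) (∫_{ℝ³} f(v) ⟨v⟩^{γ+s} dv). (Estimate (3.6) of Lemma 3.5 of the paper, which bounds (ε/2)(𝒥_{s,1}(f²,f) − 𝒥_{s,1}(f,f²)); it uses |v−v₊|^{γ+2} ≤ 2⟨v⟩^{γ+2}⟨v₊⟩^{γ+2} and εf² ≤ f.) -/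
open MeasureTheory Real

abbrev E3 := EuclideanSpace ℝ (Fin 3)

noncomputable def jap (v : E3) : ℝ := Real.sqrt (1 + ‖v‖ ^ 2)

theorem jap_pw (v w : E3) (a : ℝ) (ha : 0 < a) (ha2 : a ≤ 2) :
    ‖v - w‖ ^ a ≤ 2 * (jap v ^ a * jap w ^ a) := by
  have hv : 0 ≤ jap v := Real.sqrt_nonneg _
  have hw : 0 ≤ jap w := Real.sqrt_nonneg _
  have hv2 : jap v ^ 2 = 1 + ‖v‖ ^ 2 := Real.sq_sqrt (by positivity)
  have hw2 : jap w ^ 2 = 1 + ‖w‖ ^ 2 := Real.sq_sqrt (by positivity)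
  have h1 : ‖v - w‖ ≤ Real.sqrt 2 * (jap v * jap w) := by
    refine (pow_le_pow_iff_left₀ (norm_nonneg _) (by positivity) (two_ne_zero)).1 ?_
    rw [mul_pow, mul_pow, hv2, hw2, Real.sq_sqrt (by norm_num : (0:ℝ) ≤ 2)]
    have h3 := norm_sub_le v w
    have h4 : ‖v - w‖ ^ 2 ≤ (‖v‖ + ‖w‖) ^ 2 := by gcongr
    nlinarith [sq_nonneg (‖v‖ - ‖w‖), mul_nonneg (sq_nonneg ‖v‖) (sq_nonneg ‖w‖)]
  have h2 : Real.sqrt 2 ^ a ≤ 2 := by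
    calc Real.sqrt 2 ^ a ≤ Real.sqrt 2 ^ (2:ℝ) :=
          Real.rpow_le_rpow_of_exponent_le (by rw [Real.one_le_sqrt]; norm_num) ha2
      _ = 2 := by
          rw [Real.rpow_two]; exact Real.sq_sqrt (by norm_num)
  calc ‖v - w‖ ^ a ≤ (Real.sqrt 2 * (jap v * jap w)) ^ a :=
        Real.rpow_le_rpow (norm_nonneg _) h1 ha.le
    _ = Real.sqrt 2 ^ a * (jap v ^ a * jap w ^ a) := by
        rw [Real.mul_rpow (Real.sqrt_nonneg _) (by positivity), Real.mul_rpow hv hw]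
    _ ≤ _ := by gcongr

/-- Estimate (3.6) of Lemma 3.5. -/
theorem Js1_diff_bound (γ s ε : ℝ) (hγ₁ : -2 < γ) (hγ₂ : γ < 0) (hs : 2 < s)
    (hε : 0 < ε) (f : E3 → ℝ) (hf : Measurable f)
    (hf0 : ∀ v, 0 ≤ f v) (hfε : ∀ v, f v ≤ ε⁻¹)
    (hint1 : Integrable (fun v => f v * jap v ^ (γ + 2)))
    (hint2 : Integrable (fun v => f v * jap v ^ (s + γ))) :
    ε * s * (∫ p : E3 × E3, (f p.1) ^ 2 * f p.2 * ‖p.1 - p.2‖ ^ (γ + 2) *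
        (jap p.1 ^ (s - 2) - jap p.2 ^ (s - 2))) ≤
      2 * s * ε * ((∫ w, f w * jap w ^ (γ + 2)) * (∫ v, (f v) ^ 2 * jap v ^ (γ + s))) ∧
    2 * s * ε * ((∫ w, f w * jap w ^ (γ + 2)) * (∫ v, (f v) ^ 2 * jap v ^ (γ + s))) ≤
      2 * s * ((∫ w, f w * jap w ^ (γ + 2)) * (∫ v, f v * jap v ^ (γ + s))) := by
  have hj : ∀ v : E3, 0 < jap v := fun v => Real.sqrt_pos.2 (by positivity)
  have hjm : Measurable jap := by unfold jap; fun_prop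
  rw [add_comm s γ] at hint2
  have hsq : ∀ v, f v ^ 2 ≤ ε⁻¹ * f v := fun v => by
    rw [pow_two]; exact mul_le_mul_of_nonneg_right (hfε v) (hf0 v)
  have hint3 : Integrable (fun v => f v ^ 2 * jap v ^ (γ + s)) := by
    refine (hint2.const_mul ε⁻¹).mono' (by fun_prop) (Filter.Eventually.of_forall fun v => ?_)
    have := (Real.rpow_pos_of_pos (hj v) (γ + s)).le
    rw [Real.norm_of_nonneg (by positivity), ← mul_assoc]
    exact mul_le_mul_of_nonneg_right (hsq v) this
  have hI1 : 0 ≤ ∫ w, f w * jap w ^ (γ + 2) := integral_nonneg fun v =>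
    mul_nonneg (hf0 v) (Real.rpow_pos_of_pos (hj v) _).le
  have hI3 : 0 ≤ ∫ v, f v ^ 2 * jap v ^ (γ + s) := integral_nonneg fun v =>
    mul_nonneg (sq_nonneg _) (Real.rpow_pos_of_pos (hj v) _).le
  constructor
  · have key : (∫ p : E3 × E3, (f p.1) ^ 2 * f p.2 * ‖p.1 - p.2‖ ^ (γ + 2) *
        (jap p.1 ^ (s - 2) - jap p.2 ^ (s - 2))) ≤
        2 * ((∫ w, f w * jap w ^ (γ + 2)) * (∫ v, (f v) ^ 2 * jap v ^ (γ + s))) := by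
      by_cases hI : Integrable (fun p : E3 × E3 => (f p.1) ^ 2 * f p.2 * ‖p.1 - p.2‖ ^ (γ + 2) *
        (jap p.1 ^ (s - 2) - jap p.2 ^ (s - 2)))
      · have hR : Integrable (fun p : E3 × E3 =>
            2 * ((f p.1 ^ 2 * jap p.1 ^ (γ + s)) * (f p.2 * jap p.2 ^ (γ + 2)))) :=
          (hint3.mul_prod hint1).const_mul 2
        refine (integral_mono hI hR fun p => ?_).trans_eq ?_
        · have h1 := jap_pw p.1 p.2 (γ + 2) (by linarith) (by linarith)
          have e : jap p.1 ^ (γ + s) = jap p.1 ^ (γ + 2) * jap p.1 ^ (s - 2) := by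
            rw [← Real.rpow_add (hj _)]; congr 1; ring
          have a1 := Real.rpow_pos_of_pos (hj p.1) (s - 2)
          have a2 := Real.rpow_pos_of_pos (hj p.2) (s - 2)
          have a3 : 0 ≤ f p.1 ^ 2 * f p.2 := mul_nonneg (sq_nonneg _) (hf0 _)
          have a4 : 0 ≤ ‖p.1 - p.2‖ ^ (γ + 2) := by positivity
          calc _ ≤ f p.1 ^ 2 * f p.2 * ‖p.1 - p.2‖ ^ (γ + 2) * jap p.1 ^ (s - 2) :=
                mul_le_mul_of_nonneg_left (by linarith) (mul_nonneg a3 a4)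
            _ ≤ f p.1 ^ 2 * f p.2 * (2 * (jap p.1 ^ (γ + 2) * jap p.2 ^ (γ + 2)))
                  * jap p.1 ^ (s - 2) := by gcongr
            _ = _ := by simp only [e]; ring
        · rw [integral_const_mul, Measure.volume_eq_prod,
            integral_prod_mul (fun v => f v ^ 2 * jap v ^ (γ + s))
              (fun w => f w * jap w ^ (γ + 2))]
          ring
      · rw [integral_undef hI]; positivity
    calc _ ≤ ε * s * (2 * ((∫ w, f w * jap w ^ (γ + 2)) *
          (∫ v, (f v) ^ 2 * jap v ^ (γ + s)))) := mul_le_mul_of_nonneg_left key (by positivity)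
      _ = _ := by ring
  · have h : ε * (∫ v, (f v) ^ 2 * jap v ^ (γ + s)) ≤ ∫ v, f v * jap v ^ (γ + s) := by
      rw [← integral_const_mul]
      refine integral_mono (hint3.const_mul ε) hint2 fun v => ?_
      have h1 := Real.rpow_pos_of_pos (hj v) (γ + s)
      have h2 : ε * f v ^ 2 ≤ f v := by
        calc _ ≤ ε * (ε⁻¹ * f v) := mul_le_mul_of_nonneg_left (hsq v) hε.le
          _ = f v := by field_simp
      calc _ = ε * f v ^ 2 * jap v ^ (γ + s) := by ring
        _ ≤ _ := mul_le_mul_of_nonneg_right h2 h1.le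
    calc _ = 2 * s * ((∫ w, f w * jap w ^ (γ + 2)) *
          (ε * ∫ v, (f v) ^ 2 * jap v ^ (γ + s))) := by ring
      _ ≤ _ := by gcongr
end

section
/- Let ε₀ > 0 and let f_in ∈ L¹(ℝ³, ⟨v⟩²dv) be nonnegative with 0 < ‖f_in‖_{L^∞} = ε₀⁻¹, S_{ε₀}(f_in) > 0 and |H(f_in)| < ∞. Then: (1) there exist R > 0 and η > 0 such that for every ε ∈ (0,ε₀] and every f ∈ Y_ε(f_in), ∫_{|v| ≤ R} f(v)(1 − ε f(v)) dv ≥ η; (2) for every δ > 0 there exists η(δ) > 0 such that for every ε ∈ (0,ε₀], every f ∈ Y_ε(f_in), and every measurable set A ⊂ ℝ³ with Lebesgue measure |A| ≤ η(δ), one has ∫_A f(v)(1 − ε f(v)) dv ≤ δ. (Lemma 2.1 of the paper.) -/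
open MeasureTheory Real

/-- Fermi–Dirac entropy `S_ε(f)`. -/
noncomputable def fdEnt (ε : ℝ) (f : E3 → ℝ) : ℝ :=
  -ε⁻¹ * ∫ v, (ε * f v * Real.log (ε * f v) + (1 - ε * f v) * Real.log (1 - ε * f v))

/-- The class `Y_ε(f_in)`. -/
def memY (ε : ℝ) (fIn f : E3 → ℝ) : Prop :=
  Integrable (fun v => f v * jap v ^ (2 : ℝ)) ∧
  (∀ᵐ v : E3, 0 ≤ f v ∧ f v ≤ ε⁻¹) ∧
  (∫ v, f v) = (∫ v, fIn v) ∧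
  (∫ v, f v • v) = (∫ v, fIn v • v) ∧
  (∫ v, f v * ‖v‖ ^ 2) = (∫ v, fIn v * ‖v‖ ^ 2) ∧
  fdEnt ε fIn ≤ fdEnt ε f

noncomputable def wgt (v : E3) : ℝ := ((1 + ‖v‖) ^ 4)⁻¹

lemma wgt_pos (v : E3) : 0 < wgt v := by unfold wgt; positivity

lemma wgt_int : Integrable wgt := by
  have h := integrable_one_add_norm (E := E3) (μ := volume) (r := 4) (by simp; norm_num)
  refine h.congr (Filter.Eventually.of_forall fun v => ?_)
  have h0 : (0:ℝ) < 1 + ‖v‖ := by positivity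
  simp only [wgt]
  rw [Real.rpow_neg h0.le]
  norm_cast

lemma p1 (x c : ℝ) (hx : 0 ≤ x) (hc : 0 < c) : -(x * log x) ≤ x * log c + c⁻¹ := by
  rcases hx.eq_or_lt with rfl | hx
  · simp; exact hc.le
  have h := Real.one_sub_inv_le_log_of_pos (mul_pos hx hc)
  rw [Real.log_mul hx.ne' hc.ne'] at h
  have h2 := mul_le_mul_of_nonneg_left h hx.le
  have h3 : x * (1 - (x * c)⁻¹) = x - c⁻¹ := by field_simp
  nlinarith

lemma p2a (x : ℝ) (hx : x ≤ 1) : -((1 - x) * log (1 - x)) ≤ x := by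
  have := Real.self_sub_one_le_mul_log (x := 1 - x)  (by linarith)
  linarith

lemma p2b (x : ℝ) (h0 : 0 ≤ x) (hx : x ≤ 1) : (1 - x) * log (1 - x) ≤ 0 :=
  Real.mul_log_nonpos (by linarith) (by linarith)

lemma bin_eq (x : ℝ) : binEntropy x = -(x * log x + (1 - x) * log (1 - x)) := by
  simp [binEntropy, Real.log_inv]; ring

lemma p3a (x : ℝ) (h0 : 0 ≤ x) (h1 : x ≤ 1) : -(x * log x) ≤ 2 * √(x * (1 - x)) := by
  have hs0 := Real.sqrt_nonneg x
  have hs1 : √x ≤ 1 := by simpa using Real.sqrt_le_sqrt h1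
  have hsq := Real.sq_sqrt h0
  have h := Real.self_sub_one_le_mul_log hs0
  have hlog : x * log x = 2 * (√x * (√x * log √x)) := by
    rw [Real.log_sqrt h0]
    calc x * log x = √x ^ 2 * log x := by rw [hsq]
      _ = _ := by ring
  have h2 := mul_le_mul_of_nonneg_left h hs0
  rw [hlog]
  have : √x * (1 - √x) ≤ √(x * (1 - x)) := by
    apply Real.le_sqrt_of_sq_le
    set s := √x
    rw [← hsq]
    have : (s * (1-s))^2 = s^2 * (1-s)^2 := by ring
    rw [this]
    apply mul_le_mul_of_nonneg_left _ (sq_nonneg _)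
    nlinarith
  nlinarith

lemma p3 (x τ : ℝ) (h0 : 0 ≤ x) (h1 : x ≤ 1) (hτ : 0 < τ) :
    binEntropy x ≤ τ + 4 * (x * (1 - x)) / τ := by
  have a := p3a x h0 h1
  have b := p3a (1 - x) (by linarith) (by linarith)
  have e : (1 - x) * (1 - (1 - x)) = x * (1 - x) := by ring
  rw [e] at b
  rw [bin_eq]
  have hy : 0 ≤ x * (1 - x) := mul_nonneg h0 (by linarith)
  have hs := Real.sq_sqrt hy
  set s := √(x * (1 - x))
  rw [← hs]
  have : 4 * s ≤ τ + 4 * s ^ 2 / τ := by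
    rw [← sub_nonneg]
    have : τ + 4 * s ^ 2 / τ - 4 * s = (τ - 2 * s) ^ 2 / τ := by field_simp; ring
    rw [this]; positivity
  linarith

lemma p4 (a b x : ℝ) (ha : 0 < a) (hab : a ≤ b) (hx : 0 ≤ x) (hbx : b * x ≤ 1) :
    b⁻¹ * binEntropy (b * x) ≤ a⁻¹ * binEntropy (a * x) := by
  have hb := ha.trans_le hab
  have m1 : b * x ∈ Set.Icc (0:ℝ) 1 := ⟨by positivity, hbx⟩
  have m0 : (0:ℝ) ∈ Set.Icc (0:ℝ) 1 := by simp
  have q1 : 0 ≤ a / b := by positivity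
  have q2 : 0 ≤ 1 - a / b := by rw [sub_nonneg, div_le_one hb]; exact hab
  have h := (Real.strictConcave_binEntropy.concaveOn).2 m1 m0 q1 q2 (by ring)
  simp only [smul_eq_mul, binEntropy_zero, mul_zero, add_zero] at h
  have e : a / b * (b * x) = a * x := by field_simp
  rw [e] at h
  calc b⁻¹ * binEntropy (b * x) = a⁻¹ * (a / b * binEntropy (b * x)) := by field_simp
    _ ≤ _ := by gcongr

lemma jap_sq (v : E3) : jap v ^ (2 : ℝ) = 1 + ‖v‖ ^ 2 := by
  have : jap v ^ (2 : ℝ) = jap v ^ 2 := by norm_cast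
  rw [this, jap, Real.sq_sqrt (by positivity)]

lemma basic {f : E3 → ℝ} (h : Integrable (fun v => f v * jap v ^ (2 : ℝ))) :
    Integrable f ∧ Integrable (fun v => f v * ‖v‖ ^ 2) := by
  simp only [jap_sq] at h
  have hm : AEStronglyMeasurable f := by
    have : f = fun v => (f v * (1 + ‖v‖ ^ 2)) * (1 + ‖v‖ ^ 2)⁻¹ := by
      ext v
      have : (1 + ‖v‖ ^ 2) ≠ 0 := by positivity
      field_simp
    rw [this]
    refine h.aestronglyMeasurable.mul ?_
    apply Measurable.aestronglyMeasurable
    fun_prop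
  have hm2 : AEStronglyMeasurable (fun v => f v * ‖v‖ ^ 2) :=
    hm.mul (by apply Measurable.aestronglyMeasurable; fun_prop)
  refine ⟨h.mono hm ?_, h.mono hm2 ?_⟩
  · refine Filter.Eventually.of_forall fun v => ?_
    rw [norm_mul]
    refine le_mul_of_one_le_right (norm_nonneg _) ?_
    rw [Real.norm_of_nonneg (by positivity)]
    nlinarith [sq_nonneg ‖v‖]
  · refine Filter.Eventually.of_forall fun v => ?_
    rw [norm_mul, norm_mul]
    gcongr
    rw [Real.norm_of_nonneg (by positivity), Real.norm_of_nonneg (by positivity)]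
    linarith

lemma flogf_lower (x : ℝ) (hx : 0 ≤ x) (v : E3) :
    0 ≤ x * log x + 4 * x + 4 * (x * ‖v‖ ^ 2) + wgt v := by
  have h := p1 x ((1 + ‖v‖) ^ 4) hx (by positivity)
  rw [Real.log_pow] at h
  have hl : log (1 + ‖v‖) ≤ ‖v‖ := by
    have := Real.log_le_sub_one_of_pos (x := 1 + ‖v‖) (by positivity)
    linarith
  have h2 : log (1 + ‖v‖) ≤ 1 + ‖v‖ ^ 2 := by nlinarith [sq_nonneg (‖v‖ - 1)]
  have := mul_le_mul_of_nonneg_left h2 hx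
  unfold wgt
  push_cast at h
  nlinarith

lemma flogf_int {f : E3 → ℝ} {ε : ℝ} (hε : 0 < ε)
    (h : Integrable (fun v => f v * jap v ^ (2 : ℝ)))
    (hb : ∀ᵐ v : E3, 0 ≤ f v ∧ f v ≤ ε⁻¹) : Integrable (fun v => f v * log (f v)) := by
  obtain ⟨h1, h2⟩ := basic h
  have hd := (((h1.const_mul 4).add (h2.const_mul 4)).add wgt_int).add (h1.const_mul |log ε⁻¹|)
  refine hd.mono' ?_ ?_
  · exact (Real.continuous_mul_log.comp_aestronglyMeasurable h1.aestronglyMeasurable)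
  · filter_upwards [hb] with v hv
    have a := flogf_lower (f v) hv.1 v
    have hw := wgt_pos v
    have b : f v * log (f v) ≤ f v * |log ε⁻¹| := by
      rcases hv.1.eq_or_lt with h | h
      · rw [← h]; simp
      · exact mul_le_mul_of_nonneg_left ((Real.log_le_log h hv.2).trans (le_abs_self _)) hv.1
    have c : 0 ≤ f v * |log ε⁻¹| := mul_nonneg hv.1 (abs_nonneg _)
    have d : 0 ≤ f v * ‖v‖ ^ 2 := mul_nonneg hv.1 (by positivity)
    simp only [Pi.add_apply, Real.norm_eq_abs]
    rw [abs_le]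
    constructor <;> nlinarith [hv.1]

lemma one_int {f : E3 → ℝ} {ε : ℝ} (hε : 0 < ε)
    (h1 : Integrable f)
    (hb : ∀ᵐ v : E3, 0 ≤ f v ∧ f v ≤ ε⁻¹) :
    Integrable (fun v => (1 - ε * f v) * log (1 - ε * f v)) := by
  refine (h1.const_mul ε).mono' ?_ ?_
  · exact (Real.continuous_mul_log.comp_aestronglyMeasurable
      (aestronglyMeasurable_const.sub (h1.aestronglyMeasurable.const_mul ε)))
  · filter_upwards [hb] with v hv
    have h0 : 0 ≤ ε * f v := mul_nonneg hε.le hv.1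
    have h1 : ε * f v ≤ 1 := by
      have := mul_le_mul_of_nonneg_left hv.2 hε.le
      rwa [mul_inv_cancel₀ hε.ne'] at this
    have a := p2a _ h1
    have b := p2b _ h0 h1
    rw [Real.norm_eq_abs, abs_le]
    constructor <;> linarith

lemma pt_split {ε x : ℝ} (hε : 0 < ε) (hx : 0 ≤ x) :
    binEntropy (ε * x) = -ε * (x * log x) - ε * log ε * x - (1 - ε * x) * log (1 - ε * x) := by
  rw [bin_eq]
  rcases hx.eq_or_lt with rfl | h
  · simp
  rw [Real.log_mul hε.ne' h.ne']
  ring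

lemma fd_bin {f : E3 → ℝ} {ε : ℝ} : fdEnt ε f = ∫ v, ε⁻¹ * binEntropy (ε * f v) := by
  unfold fdEnt
  simp only [bin_eq]
  rw [integral_const_mul, integral_neg]
  ring

lemma bin_int {f : E3 → ℝ} {ε : ℝ} (hε : 0 < ε)
    (h : Integrable (fun v => f v * jap v ^ (2 : ℝ)))
    (hb : ∀ᵐ v : E3, 0 ≤ f v ∧ f v ≤ ε⁻¹) :
    Integrable (fun v => ε⁻¹ * binEntropy (ε * f v)) := by
  apply Integrable.const_mul
  obtain ⟨h1, h2⟩ := basic h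
  refine ((((flogf_int hε h hb).const_mul (-ε)).sub (h1.const_mul (ε * log ε))).sub
    (one_int hε h1 hb)).congr ?_
  filter_upwards [hb] with v hv
  simp only [Pi.sub_apply]
  rw [pt_split hε hv.1]

lemma fd_split {f : E3 → ℝ} {ε : ℝ} (hε : 0 < ε)
    (h : Integrable (fun v => f v * jap v ^ (2 : ℝ)))
    (hb : ∀ᵐ v : E3, 0 ≤ f v ∧ f v ≤ ε⁻¹) :
    fdEnt ε f = -(∫ v, f v * log (f v)) - log ε * (∫ v, f v)
      - ε⁻¹ * ∫ v, (1 - ε * f v) * log (1 - ε * f v) := by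
  obtain ⟨h1, h2⟩ := basic h
  rw [fd_bin, integral_const_mul]
  have : ∫ v, binEntropy (ε * f v) = ∫ v, (-ε * (f v * log (f v)) - ε * log ε * f v
      - (1 - ε * f v) * log (1 - ε * f v)) := by
    apply integral_congr_ae
    filter_upwards [hb] with v hv
    rw [pt_split hε hv.1]
  have key : Integrable (fun v => -ε * (f v * log (f v)) - ε * log ε * f v) :=
    ((flogf_int hε h hb).const_mul (-ε)).sub (h1.const_mul (ε * log ε))
  rw [this, integral_sub key (one_int hε h1 hb), integral_sub ((flogf_int hε h hb).const_mul (-ε))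
      (h1.const_mul (ε * log ε)), integral_const_mul, integral_const_mul]
  field_simp

lemma H_bound {f fIn : E3 → ℝ} {ε : ℝ} (hε : 0 < ε)
    (hIn : Integrable (fun v => fIn v * jap v ^ (2 : ℝ)))
    (hbIn : ∀ᵐ v : E3, 0 ≤ fIn v ∧ fIn v ≤ ε⁻¹) (hf : memY ε fIn f) :
    ∫ v, f v * log (f v) ≤ (∫ v, fIn v * log (fIn v)) + ∫ v, fIn v := by
  obtain ⟨h, hb, hM, -, -, hS⟩ := hf
  rw [fd_split hε h hb, fd_split hε hIn hbIn, hM] at hS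
  have hle : ∀ x, 0 ≤ x → x ≤ ε⁻¹ → ε * x ≤ 1 := fun x _ hx => by
    have := mul_le_mul_of_nonneg_left hx hε.le
    rwa [mul_inv_cancel₀ hε.ne'] at this
  have a : ∫ v, (1 - ε * fIn v) * log (1 - ε * fIn v) ≤ 0 := by
    apply integral_nonpos_of_ae
    filter_upwards [hbIn] with v hv
    exact p2b _ (mul_nonneg hε.le hv.1) (hle _ hv.1 hv.2)
  have b : -(∫ v, (1 - ε * f v) * log (1 - ε * f v)) ≤ ∫ v, ε * f v := by
    rw [← integral_neg]
    refine integral_mono_ae (one_int hε (basic h).1 hb).neg ((basic h).1.const_mul ε) ?_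
    filter_upwards [hb] with v hv
    exact p2a _ (hle _ hv.1 hv.2)
  rw [integral_const_mul, hM] at b
  have hi : 0 < ε⁻¹ := inv_pos.2 hε
  have b' := mul_le_mul_of_nonneg_left b hi.le
  have e : ε⁻¹ * (ε * ∫ v, fIn v) = ∫ v, fIn v := by field_simp
  rw [e] at b'
  have a' := mul_le_mul_of_nonneg_left a hi.le
  linarith

/-- the bounding constant -/
noncomputable def Bc (fIn : E3 → ℝ) : ℝ :=
  (∫ v, fIn v * log (fIn v)) + 5 * (∫ v, fIn v) + 4 * (∫ v, fIn v * ‖v‖ ^ 2) + ∫ v, wgt v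

/-- the nonnegative majorant -/
noncomputable def maj (f : E3 → ℝ) (v : E3) : ℝ :=
  f v * log (f v) + 4 * f v + 4 * (f v * ‖v‖ ^ 2) + wgt v

lemma maj_bound {f fIn : E3 → ℝ} {ε : ℝ} (hε : 0 < ε)
    (hIn : Integrable (fun v => fIn v * jap v ^ (2 : ℝ)))
    (hbIn : ∀ᵐ v : E3, 0 ≤ fIn v ∧ fIn v ≤ ε⁻¹) (hf : memY ε fIn f) :
    Integrable (maj f) ∧ (∀ᵐ v, 0 ≤ maj f v) ∧ ∫ v, maj f v ≤ Bc fIn := by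
  have hH := H_bound hε hIn hbIn hf
  obtain ⟨h, hb, hM, -, hE, hS⟩ := hf
  obtain ⟨h1, h2⟩ := basic h
  have i0 := flogf_int hε h hb
  have i1 := h1.const_mul 4
  have i2 := h2.const_mul 4
  have i01 : Integrable (fun v => f v * log (f v) + 4 * f v) := i0.add i1
  have i012 : Integrable (fun v => f v * log (f v) + 4 * f v + 4 * (f v * ‖v‖ ^ 2)) := i01.add i2
  refine ⟨i012.add wgt_int, ?_, ?_⟩
  · filter_upwards [hb] with v hv using flogf_lower _ hv.1 v
  · unfold maj Bc
    rw [integral_add i012 wgt_int, integral_add i01 i2,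
      integral_add i0 i1, integral_const_mul, integral_const_mul, hM, hE]
    linarith

/-- pointwise: `f ≤ K + maj f / log K`, and stronger. -/
lemma pt_K {x m K : ℝ} (hK : 1 < K) (hx : 0 ≤ x) (hm : x * log x ≤ m) (hxK : K < x) :
    x ≤ m / log K := by
  have hl := Real.log_pos hK
  rw [le_div_iff₀ hl]
  have : log K ≤ log x := Real.log_le_log (by linarith) hxK.le
  nlinarith

lemma maj_ge {f : E3 → ℝ} {v : E3} (hv : 0 ≤ f v) : f v * log (f v) ≤ maj f v := by
  unfold maj
  have := wgt_pos v
  have d : 0 ≤ f v * ‖v‖ ^ 2 := mul_nonneg hv (by positivity)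
  linarith

lemma exists_K (B δ : ℝ) (hδ : 0 < δ) : ∃ K > (1:ℝ), B / log K ≤ δ := by
  refine ⟨Real.exp (|B| / δ + 1), ?_, ?_⟩
  · apply Real.one_lt_exp_iff.2; positivity
  · rw [Real.log_exp, div_le_iff₀ (by positivity)]
    have : δ * (|B| / δ + 1) = |B| + δ := by field_simp
    rw [this]; linarith [le_abs_self B]

lemma y_int {f : E3 → ℝ} {ε : ℝ} (hε : 0 < ε) (h1 : Integrable f)
    (hb : ∀ᵐ v : E3, 0 ≤ f v ∧ f v ≤ ε⁻¹) :
    Integrable (fun v => f v * (1 - ε * f v)) := by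
  refine h1.mono (h1.aestronglyMeasurable.mul
    (aestronglyMeasurable_const.sub (h1.aestronglyMeasurable.const_mul ε))) ?_
  filter_upwards [hb] with v hv
  have h0 : 0 ≤ ε * f v := mul_nonneg hε.le hv.1
  have h1 : ε * f v ≤ 1 := by
    have := mul_le_mul_of_nonneg_left hv.2 hε.le
    rwa [mul_inv_cancel₀ hε.ne'] at this
  rw [norm_mul]
  refine mul_le_of_le_one_right (norm_nonneg _) ?_
  rw [Real.norm_eq_abs, abs_le]
  constructor <;> linarith

lemma part2 (ε₀ : ℝ) (hε₀ : 0 < ε₀) (fIn : E3 → ℝ)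
    (hIn : Integrable (fun v => fIn v * jap v ^ (2 : ℝ)))
    (hbIn : ∀ ε ∈ Set.Ioc (0 : ℝ) ε₀, ∀ᵐ v : E3, 0 ≤ fIn v ∧ fIn v ≤ ε⁻¹) :
    (∀ δ > (0 : ℝ), ∃ η' > (0 : ℝ), ∀ ε ∈ Set.Ioc (0 : ℝ) ε₀, ∀ f : E3 → ℝ, memY ε fIn f →
      ∀ A : Set E3, MeasurableSet A → volume A ≤ ENNReal.ofReal η' →
        (∫ v in A, f v * (1 - ε * f v)) ≤ δ) := by
  intro δ hδ
  obtain ⟨K, hK, hKB⟩ := exists_K (Bc fIn) (δ / 2) (by positivity)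
  have hK0 : 0 < K := by linarith
  refine ⟨δ / (2 * K), by positivity, ?_⟩
  intro ε hε f hf A hA hvol
  obtain ⟨mi, m0, mB⟩ := maj_bound hε.1 hIn (hbIn ε hε) hf
  obtain ⟨h, hb, hM, -, hE, hS⟩ := hf
  obtain ⟨h1, h2⟩ := basic h
  have hl := Real.log_pos hK
  have hfin : volume A ≠ ⊤ := ne_top_of_le_ne_top ENNReal.ofReal_ne_top hvol
  have ic : IntegrableOn (fun _ : E3 => K) A := integrableOn_const hfin
  have im : Integrable (fun v => maj f v / log K) := mi.div_const _
  calc (∫ v in A, f v * (1 - ε * f v)) ≤ ∫ v in A, (K + maj f v / log K) := by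
        refine integral_mono_ae (y_int hε.1 h1 hb).integrableOn (ic.add im.integrableOn) ?_
        refine ae_restrict_of_ae ?_
        filter_upwards [hb, m0] with v hv hm
        have h0 : 0 ≤ ε * f v := mul_nonneg hε.1.le hv.1
        have hle : f v * (1 - ε * f v) ≤ f v := mul_le_of_le_one_right hv.1 (by linarith)
        have hq : 0 ≤ maj f v / log K := by positivity
        by_cases hx : K < f v
        · have := pt_K hK hv.1 (maj_ge hv.1) hx
          linarith
        · linarith
    _ = (volume.real A) * K + ∫ v in A, maj f v / log K := by
        rw [integral_add ic im.integrableOn]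
        simp
    _ ≤ δ / (2 * K) * K + ∫ v, maj f v / log K := by
        refine add_le_add (mul_le_mul_of_nonneg_right ?_ hK0.le) ?_
        · exact ENNReal.toReal_le_of_le_ofReal (by positivity) hvol
        · refine setIntegral_le_integral im ?_
          filter_upwards [m0] with v hm
          simp only [Pi.zero_apply]; positivity
    _ ≤ δ / 2 + δ / 2 := by
        rw [integral_div]
        have e : δ / (2 * K) * K = δ / 2 := by field_simp
        rw [e]
        have : (∫ v, maj f v) / log K ≤ Bc fIn / log K := by gcongr
        linarith
    _ = δ := by ring

lemma y_nonneg {ε x : ℝ} (hε : 0 < ε) (hx : 0 ≤ x ∧ x ≤ ε⁻¹) : 0 ≤ x * (1 - ε * x) := by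
  have := mul_le_mul_of_nonneg_left hx.2 hε.le
  rw [mul_inv_cancel₀ hε.ne'] at this
  exact mul_nonneg hx.1 (by linarith)

lemma caseA {f fIn : E3 → ℝ} {ε K R : ℝ} (hε : 0 < ε) (hK : 1 < K) (hεK : ε ≤ 1 / (2 * K))
    (hR : 1 ≤ R)
    (hIn : Integrable (fun v => fIn v * jap v ^ (2 : ℝ)))
    (hbIn : ∀ᵐ v : E3, 0 ≤ fIn v ∧ fIn v ≤ ε⁻¹) (hf : memY ε fIn f) :
    1 / 2 * ((∫ v, fIn v) - Bc fIn / log K - (∫ v, fIn v * ‖v‖ ^ 2) / R) ≤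
      ∫ v in {v : E3 | ‖v‖ ≤ R}, f v * (1 - ε * f v) := by
  obtain ⟨mi, m0, mB⟩ := maj_bound hε hIn hbIn hf
  obtain ⟨h, hb, hM, -, hE, hS⟩ := hf
  obtain ⟨h1, h2⟩ := basic h
  have hl := Real.log_pos hK
  have hmeas : MeasurableSet {v : E3 | ‖v‖ ≤ R} := measurableSet_le (by fun_prop) (by fun_prop)
  have im : Integrable (fun v => maj f v / log K) := mi.div_const _
  have i2 : Integrable (fun v => f v * ‖v‖ ^ 2 / R) := h2.div_const _
  have i1 : Integrable (fun v => f v - maj f v / log K) := h1.sub im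
  have i3 : Integrable (fun v => f v - maj f v / log K - f v * ‖v‖ ^ 2 / R) := i1.sub i2
  rw [← integral_indicator hmeas]
  have hmono : ∫ v, 1 / 2 * (f v - maj f v / log K - f v * ‖v‖ ^ 2 / R) ≤
      ∫ v, Set.indicator {v : E3 | ‖v‖ ≤ R} (fun v => f v * (1 - ε * f v)) v := by
    refine integral_mono_ae (i3.const_mul _) ((y_int hε h1 hb).indicator hmeas) ?_
    filter_upwards [hb, m0] with v hv hm
    have hq : 0 ≤ maj f v / log K := by positivity
    have hw : 0 ≤ f v * ‖v‖ ^ 2 / R := div_nonneg (mul_nonneg hv.1 (by positivity)) (by linarith)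
    have hy := y_nonneg hε hv
    by_cases hvR : ‖v‖ ≤ R
    · rw [Set.indicator_of_mem (by exact hvR)]
      by_cases hx : K < f v
      · have := pt_K hK hv.1 (maj_ge hv.1) hx
        linarith
      · have : ε * f v ≤ 1 / 2 := by
          calc ε * f v ≤ 1 / (2 * K) * K :=
                mul_le_mul hεK (not_lt.1 hx) hv.1 (by positivity)
            _ = 1 / 2 := by field_simp
        nlinarith [hv.1]
    · rw [Set.indicator_of_notMem (by exact hvR)]
      have : f v ≤ f v * ‖v‖ ^ 2 / R := by
        rw [le_div_iff₀ (by linarith)]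
        apply mul_le_mul_of_nonneg_left _ hv.1
        nlinarith
      linarith
  rw [integral_const_mul, integral_sub i1 i2, integral_sub h1 im, integral_div, integral_div,
    hM, hE] at hmono
  refine le_trans ?_ hmono
  gcongr

lemma out_pt {ε ε₁ x R : ℝ} {v : E3} (hε₁ : 0 < ε₁) (hε : ε₁ ≤ ε) (hx : 0 ≤ x ∧ x ≤ ε⁻¹)
    (hR : 1 ≤ R) (hv : R ≤ ‖v‖) :
    ε⁻¹ * binEntropy (ε * x) ≤ ((6 + |log ε₁|) * (x * ‖v‖ ^ 2) + wgt v) / R := by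
  have hε0 : 0 < ε := hε₁.trans_le hε
  have hn : 1 ≤ ‖v‖ := hR.trans hv
  have hR0 : 0 < R := by linarith
  rw [pt_split hε0 hx.1]
  have h1 : ε * x ≤ 1 := by
    have := mul_le_mul_of_nonneg_left hx.2 hε0.le
    rwa [mul_inv_cancel₀ hε0.ne'] at this
  have a := p2a _ h1
  have s1 : ε⁻¹ * (-ε * (x * log x) - ε * log ε * x - (1 - ε * x) * log (1 - ε * x)) ≤
      -(x * log x) + x * (-log ε) + x := by
    have e : -(x * log x) + x * (-log ε) + x = ε⁻¹ * (-ε * (x * log x) - ε * log ε * x + ε * x) := by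
      field_simp; ring
    rw [e]
    apply mul_le_mul_of_nonneg_left _ (inv_pos.2 hε0).le
    linarith
  refine s1.trans ?_
  have hL : -log ε ≤ |log ε₁| := by
    have := Real.log_le_log hε₁ hε
    linarith [neg_abs_le (log ε₁)]
  have hxn : x * ‖v‖ ≤ x * ‖v‖ ^ 2 / R := by
    rw [le_div_iff₀ hR0, mul_assoc]
    apply mul_le_mul_of_nonneg_left _ hx.1
    nlinarith
  have hx1 : x ≤ x * ‖v‖ := le_mul_of_one_le_right hx.1 hn
  have hp := p1 x ((1 + ‖v‖) ^ 5) hx.1 (by positivity)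
  rw [Real.log_pow] at hp
  push_cast at hp
  have hl : log (1 + ‖v‖) ≤ ‖v‖ := by
    have := Real.log_le_sub_one_of_pos (x := 1 + ‖v‖) (by positivity)
    linarith
  have hl2 := mul_le_mul_of_nonneg_left hl hx.1
  have hw : ((1 + ‖v‖) ^ 5)⁻¹ ≤ wgt v / R := by
    unfold wgt
    rw [pow_succ, mul_inv, div_eq_mul_inv]
    gcongr
    linarith
  have hL2 := mul_le_mul_of_nonneg_left hL hx.1
  have hL3 : x * |log ε₁| ≤ (x * ‖v‖ ^ 2 / R) * |log ε₁| :=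
    mul_le_mul_of_nonneg_right (hx1.trans hxn) (abs_nonneg _)
  have e : ((6 + |log ε₁|) * (x * ‖v‖ ^ 2) + wgt v) / R =
    6 * (x * ‖v‖ ^ 2 / R) + (x * ‖v‖ ^ 2 / R) * |log ε₁| + wgt v / R := by ring
  rw [e]
  nlinarith

lemma caseB {f fIn : E3 → ℝ} {ε ε₁ R τ : ℝ} (hε₁ : 0 < ε₁) (hε : ε₁ ≤ ε) (hτ : 0 < τ)
    (hR : 1 ≤ R) (hf : memY ε fIn f) :
    fdEnt ε f ≤ ε₁⁻¹ * τ * volume.real {v : E3 | ‖v‖ ≤ R} +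
      4 / τ * (∫ v in {v : E3 | ‖v‖ ≤ R}, f v * (1 - ε * f v)) +
      ((6 + |log ε₁|) * (∫ v, fIn v * ‖v‖ ^ 2) + ∫ v, wgt v) / R := by
  have hε0 : 0 < ε := hε₁.trans_le hε
  obtain ⟨h, hb, hM, -, hE, hS⟩ := hf
  obtain ⟨h1, h2⟩ := basic h
  have hmeas : MeasurableSet {v : E3 | ‖v‖ ≤ R} := measurableSet_le (by fun_prop) (by fun_prop)
  have hfin : volume {v : E3 | ‖v‖ ≤ R} ≠ ⊤ := by
    have : {v : E3 | ‖v‖ ≤ R} = Metric.closedBall 0 R := by ext; simp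
    rw [this]; exact measure_closedBall_lt_top.ne
  rw [fd_bin, ← integral_indicator hmeas]
  have ic : Integrable (Set.indicator {v : E3 | ‖v‖ ≤ R} (fun _ : E3 => ε₁⁻¹ * τ)) :=
    (integrable_indicator_iff hmeas).2 (integrableOn_const hfin)
  have iy : Integrable (fun v => 4 / τ *
      Set.indicator {v : E3 | ‖v‖ ≤ R} (fun v => f v * (1 - ε * f v)) v) :=
    ((y_int hε0 h1 hb).indicator hmeas).const_mul _
  have io' : Integrable (fun v => (6 + |log ε₁|) * (f v * ‖v‖ ^ 2)) := h2.const_mul _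
  have io : Integrable (fun v => ((6 + |log ε₁|) * (f v * ‖v‖ ^ 2) + wgt v) / R) :=
    (io'.add wgt_int).div_const _
  have icy : Integrable (fun v => Set.indicator {v : E3 | ‖v‖ ≤ R} (fun _ : E3 => ε₁⁻¹ * τ) v
    + 4 / τ * Set.indicator {v : E3 | ‖v‖ ≤ R} (fun v => f v * (1 - ε * f v)) v) := ic.add iy
  have hmono : ∫ v, ε⁻¹ * binEntropy (ε * f v) ≤
      ∫ v, (Set.indicator {v : E3 | ‖v‖ ≤ R} (fun _ : E3 => ε₁⁻¹ * τ) v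
    + 4 / τ * Set.indicator {v : E3 | ‖v‖ ≤ R} (fun v => f v * (1 - ε * f v)) v
    + ((6 + |log ε₁|) * (f v * ‖v‖ ^ 2) + wgt v) / R) := by
    refine integral_mono_ae (bin_int hε0 h hb) (icy.add io) ?_
    filter_upwards [hb] with v hv
    by_cases hvR : ‖v‖ ≤ R
    · rw [Set.indicator_of_mem (by exact hvR), Set.indicator_of_mem (by exact hvR)]
      have h0 : 0 ≤ ε * f v := mul_nonneg hε0.le hv.1
      have h1 : ε * f v ≤ 1 := by
        have := mul_le_mul_of_nonneg_left hv.2 hε0.le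
        rwa [mul_inv_cancel₀ hε0.ne'] at this
      have hp := mul_le_mul_of_nonneg_left (p3 _ τ h0 h1 hτ) (inv_pos.2 hε0).le
      have e : ε⁻¹ * (τ + 4 * (ε * f v * (1 - ε * f v)) / τ) =
        ε⁻¹ * τ + 4 / τ * (f v * (1 - ε * f v)) := by field_simp
      rw [e] at hp
      have hi : ε⁻¹ * τ ≤ ε₁⁻¹ * τ := by gcongr
      have hw := (wgt_pos v).le
      have hfv := hv.1
      have : 0 ≤ ((6 + |log ε₁|) * (f v * ‖v‖ ^ 2) + wgt v) / R := by positivity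
      linarith
    · rw [Set.indicator_of_notMem (by exact hvR), Set.indicator_of_notMem (by exact hvR)]
      have := out_pt hε₁ hε hv hR (not_le.1 hvR).le
      linarith
  refine hmono.trans (le_of_eq ?_)
  rw [integral_add icy io, integral_add ic iy, integral_const_mul (4 / τ), integral_div,
    integral_add io' wgt_int, integral_const_mul (6 + |log ε₁|), hE,
    integral_indicator_const _ hmeas, smul_eq_mul, mul_comm (volume.real _)]

lemma part1 (ε₀ : ℝ) (fIn : E3 → ℝ)
    (hIn : Integrable (fun v => fIn v * jap v ^ (2 : ℝ)))
    (hbIn : ∀ ε ∈ Set.Ioc (0 : ℝ) ε₀, ∀ᵐ v : E3, 0 ≤ fIn v ∧ fIn v ≤ ε⁻¹)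
    (hM : 0 < ∫ v, fIn v) (hS : 0 < fdEnt ε₀ fIn)  :
    (∃ R > (0 : ℝ), ∃ η > (0 : ℝ), ∀ ε ∈ Set.Ioc (0 : ℝ) ε₀, ∀ f : E3 → ℝ, memY ε fIn f →
      η ≤ ∫ v in {v : E3 | ‖v‖ ≤ R}, f v * (1 - ε * f v)) := by
  obtain ⟨K, hK, hKB⟩ := exists_K (Bc fIn) ((∫ v, fIn v) / 4) (by positivity)
  have hK0 : 0 < K := by linarith
  set M := ∫ v, fIn v
  set E := ∫ v, fIn v * ‖v‖ ^ 2 with hEdef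
  set S := fdEnt ε₀ fIn with hSdef
  set ε₁ := 1 / (2 * K) with hε₁def
  have hε₁ : 0 < ε₁ := by positivity
  set C := (6 + |log ε₁|) * E + ∫ v, wgt v with hC
  set R := 1 + 4 * |E| / M + 4 * |C| / S with hRdef
  have q1 : 0 ≤ 4 * |E| / M := by positivity
  have q2 : 0 ≤ 4 * |C| / S := by positivity
  have hR : 1 ≤ R := by linarith
  have hR0 : 0 < R := by linarith
  have hER : E / R ≤ M / 4 := by
    rw [div_le_iff₀ hR0]
    have : M / 4 * (4 * |E| / M) = |E| := by field_simp
    have h2 : M / 4 * (4 * |E| / M) ≤ M / 4 * R := by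
      apply mul_le_mul_of_nonneg_left _ (by positivity); linarith
    linarith [le_abs_self E]
  have hCR : C / R ≤ S / 4 := by
    rw [div_le_iff₀ hR0]
    have : S / 4 * (4 * |C| / S) = |C| := by field_simp
    have h2 : S / 4 * (4 * |C| / S) ≤ S / 4 * R := by
      apply mul_le_mul_of_nonneg_left _ (by positivity); linarith
    linarith [le_abs_self C]
  set V := volume.real {v : E3 | ‖v‖ ≤ R}
  have hV : 0 ≤ V := measureReal_nonneg
  set τ := ε₁ * S / (4 * (V + 1)) with hτdef
  have hτ : 0 < τ := by positivity
  refine ⟨R, hR0, min (M / 4) (τ * S / 8), by positivity, ?_⟩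
  intro ε hε f hf
  rcases le_total ε ε₁ with hc | hc
  · have := caseA hε.1 hK hc hR hIn (hbIn ε hε) hf
    refine le_trans (min_le_left _ _) (le_trans ?_ this)
    linarith
  · have hB := caseB hε₁ hc hτ hR hf
    refine le_trans (min_le_right _ _) ?_
    have hS1 : S ≤ fdEnt ε f := by
      refine le_trans ?_ hf.2.2.2.2.2
      rw [hSdef, fd_bin, fd_bin]
      have hε₀ : 0 < ε₀ := hε.1.trans_le hε.2
      refine integral_mono_ae (bin_int hε₀ hIn (hbIn _ ⟨hε₀, le_rfl⟩))
        (bin_int hε.1 hIn (hbIn _ hε)) ?_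
      filter_upwards [hbIn _ ⟨hε₀, le_rfl⟩] with v hv
      refine p4 _ _ _ hε.1 hε.2 hv.1 ?_
      have := mul_le_mul_of_nonneg_left hv.2 hε₀.le
      rwa [mul_inv_cancel₀ hε₀.ne'] at this
    have hV1 : ε₁⁻¹ * τ * V ≤ S / 4 := by
      have e : ε₁⁻¹ * τ * V = S / 4 * (V / (V + 1)) := by rw [hτdef]; field_simp
      rw [e]
      refine mul_le_of_le_one_right (by positivity) ?_
      rw [div_le_one (by positivity)]; linarith
    set I := ∫ v in {v : E3 | ‖v‖ ≤ R}, f v * (1 - ε * f v)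
    have h4 : S / 2 ≤ 4 / τ * I := by linarith
    have h5 := mul_le_mul_of_nonneg_left h4 hτ.le
    have e : τ * (4 / τ * I) = 4 * I := by field_simp
    rw [e] at h5
    linarith

/-- Lemma 2.1 of the paper. -/
theorem lemma_two_one (ε₀ : ℝ) (hε₀ : 0 < ε₀) (fIn : E3 → ℝ)
    (hfIn0 : ∀ v, 0 ≤ fIn v)
    (hfInL12 : Integrable (fun v => fIn v * jap v ^ (2 : ℝ)))
    (hfInLinf : eLpNorm fIn ⊤ volume = ENNReal.ofReal ε₀⁻¹)
    (hS : 0 < fdEnt ε₀ fIn)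
    (hH : Integrable (fun v => fIn v * Real.log (fIn v))) :
    (∃ R > (0 : ℝ), ∃ η > (0 : ℝ), ∀ ε ∈ Set.Ioc (0 : ℝ) ε₀, ∀ f : E3 → ℝ, memY ε fIn f →
      η ≤ ∫ v in {v : E3 | ‖v‖ ≤ R}, f v * (1 - ε * f v)) ∧
    (∀ δ > (0 : ℝ), ∃ η' > (0 : ℝ), ∀ ε ∈ Set.Ioc (0 : ℝ) ε₀, ∀ f : E3 → ℝ, memY ε fIn f →
      ∀ A : Set E3, MeasurableSet A → volume A ≤ ENNReal.ofReal η' →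
        (∫ v in A, f v * (1 - ε * f v)) ≤ δ) := by
  
  have hb0 : ∀ᵐ v : E3, fIn v ≤ ε₀⁻¹ := by
    have h := ae_le_eLpNormEssSup (f := fIn) (μ := volume)
    rw [← eLpNorm_exponent_top, hfInLinf] at h
    filter_upwards [h] with v hv
    rw [← ofReal_norm, ENNReal.ofReal_le_ofReal_iff (by positivity)] at hv
    exact (le_abs_self _).trans hv
  have hbIn : ∀ ε ∈ Set.Ioc (0 : ℝ) ε₀, ∀ᵐ v : E3, 0 ≤ fIn v ∧ fIn v ≤ ε⁻¹ := by
    intro ε hε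
    filter_upwards [hb0] with v hv
    exact ⟨hfIn0 v, hv.trans (inv_anti₀ hε.1 hε.2)⟩
  have hM : 0 < ∫ v, fIn v := by
    refine lt_of_le_of_ne (integral_nonneg hfIn0) fun h0 => ?_
    have hz := (integral_eq_zero_iff_of_nonneg hfIn0 (basic hfInL12).1).1 h0.symm
    rw [eLpNorm_congr_ae hz, eLpNorm_zero] at hfInLinf
    have : (0:ℝ) < ε₀⁻¹ := by positivity
    have := ENNReal.ofReal_pos.2 this
    rw [← hfInLinf] at this
    exact lt_irrefl _ this
  exact ⟨part1 ε₀ fIn hfInL12 hbIn hM hS, part2 ε₀ hε₀ fIn hfInL12 hbIn⟩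
end

section
/- Let g : ℝ³ → ℝ be nonnegative and measurable. (i) If γ ∈ [−1, 0) and ∫ g(v)⟨v⟩^{1+γ} dv < ∞, then for every v ∈ ℝ³, |b[g](v)| ≤ 2^{(3+γ)/2} ⟨v⟩^{1+γ} ∫_{ℝ³} g(v₊)⟨v₊⟩^{1+γ} dv₊. (ii) If γ ∈ (−2, −1) and g ∈ L¹(ℝ³) ∩ L²(ℝ³), then there exists a constant C > 0 depending only on γ such that for every v ∈ ℝ³, |b[g](v)| ≤ C ( ‖g‖_{L¹} + ‖g‖_{L²} ). (Pointwise bounds (3.18)–(3.19) on the drift field b[g], established in the proof of Corollary 3.13 of the paper.) -/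
open MeasureTheory Real

/-- The drift field `b[g](v) = -2 ∫ (v-v₊)|v-v₊|^γ g(v₊) dv₊`. -/
noncomputable def bfield (γ : ℝ) (g : E3 → ℝ) (v : E3) : E3 :=
  (-2 : ℝ) • ∫ w, (‖v - w‖ ^ γ * g w) • (v - w)

lemma aux_norm (γ : ℝ) (g : E3 → ℝ) (hg : ∀ v, 0 ≤ g v) (v w : E3) :
    ‖(‖v - w‖ ^ γ * g w) • (v - w)‖ = ‖v - w‖ ^ γ * ‖v - w‖ * g w := by
  rw [norm_smul, Real.norm_of_nonneg (mul_nonneg (by positivity) (hg w))]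
  ring

lemma aux_le (γ : ℝ) (v w : E3) :
    ‖v - w‖ ^ γ * ‖v - w‖ ≤ ‖v - w‖ ^ (1 + γ) := by
  rcases (norm_nonneg (v - w)).eq_or_lt with h | h
  · rw [← h]; simp only [mul_zero]; positivity
  · rw [Real.rpow_add h, Real.rpow_one, mul_comm]

lemma aux_jap (v w : E3) : ‖v - w‖ ≤ Real.sqrt 2 * (jap v * jap w) := by
  unfold jap
  rw [← Real.sqrt_mul (by positivity), ← Real.sqrt_mul (by positivity)]
  apply Real.le_sqrt_of_sq_le
  have h := norm_sub_le v w
  have h0 := norm_nonneg (v - w)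
  have : ‖v - w‖ ^ 2 ≤ (‖v‖ + ‖w‖) ^ 2 := by gcongr
  nlinarith [sq_nonneg (‖v‖ - ‖w‖), sq_nonneg (‖v‖ * ‖w‖)]

lemma norm_bfield (γ : ℝ) (g : E3 → ℝ) (v : E3) :
    ‖bfield γ g v‖ = 2 * ‖∫ w, (‖v - w‖ ^ γ * g w) • (v - w)‖ := by
  rw [bfield, norm_smul]; norm_num

noncomputable def ker (β : ℝ) (x : E3) : ℝ :=
  (Metric.ball (0 : E3) 1).indicator (fun x => ‖x‖ ^ β) x

lemma ker_nonneg (β : ℝ) (x : E3) : 0 ≤ ker β x :=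
  Set.indicator_nonneg (fun x _ => by positivity) x

lemma ker_meas (β : ℝ) : Measurable (ker β) :=
  Measurable.indicator (by fun_prop) measurableSet_ball

lemma ker_sq (β : ℝ) (hβ : -1 < β) : Integrable (fun x : E3 => ker β x ^ 2) := by
  have h : IntegrableOn (fun x : E3 => (‖x‖ ^ β) ^ 2) (Metric.ball (0 : E3) 1) := by
    refine integrableOn_ball_of_norm_le_rpow (C := 1) (α := -(2 * β)) (by simp) ?_ ?_ ?_
    · simp; linarith
    · refine Filter.Eventually.of_forall fun x => ?_
      rw [Real.norm_of_nonneg (by positivity), ← Real.rpow_natCast, ← Real.rpow_mul (norm_nonneg _)]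
      simp [mul_comm]
    · exact (by fun_prop : Measurable fun x : E3 => (‖x‖ ^ β) ^ 2).aestronglyMeasurable
  rw [← integrable_indicator_iff measurableSet_ball] at h
  refine h.congr (Filter.Eventually.of_forall fun x => ?_)
  by_cases hx : x ∈ Metric.ball (0 : E3) 1 <;> simp only [ker, Set.indicator, hx] <;> simp

lemma le_ker (β : ℝ) (hβ : β < 0) (x : E3) : ‖x‖ ^ β ≤ 1 + ker β x := by
  by_cases hx : x ∈ Metric.ball (0 : E3) 1
  · simp [ker, hx]
  · have : 1 ≤ ‖x‖ := by simpa using hx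
    have := Real.rpow_le_one_of_one_le_of_nonpos this hβ.le
    linarith [ker_nonneg β x]

/-- Pointwise bounds (3.18)–(3.19) on the drift field `b[g]`. -/
theorem bfield_pointwise_bounds (γ : ℝ) (hγ₁ : -2 < γ) (hγ₂ : γ < 0) :
    ((-1 ≤ γ → ∀ g : E3 → ℝ, Measurable g → (∀ v, 0 ≤ g v) →
      Integrable (fun v => g v * jap v ^ (1 + γ)) →
      ∀ v : E3, ‖bfield γ g v‖ ≤
        (2 : ℝ) ^ ((3 + γ) / 2) * jap v ^ (1 + γ) * (∫ w, g w * jap w ^ (1 + γ))) ∧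
    (γ < -1 → ∃ C > (0 : ℝ), ∀ g : E3 → ℝ, Measurable g → (∀ v, 0 ≤ g v) →
      Integrable g → Integrable (fun v => (g v) ^ 2) →
      ∀ v : E3, ‖bfield γ g v‖ ≤
        C * ((∫ w, g w) + (∫ w, (g w) ^ 2) ^ ((1 : ℝ) / 2)))) := by
  constructor
  · intro h1 g hgm hg hint v
    have hj : ∀ w, 0 ≤ jap w := fun w => Real.sqrt_nonneg _
    have key : ‖∫ w, (‖v - w‖ ^ γ * g w) • (v - w)‖ ≤
        ∫ w, ((2 : ℝ) ^ ((1 + γ) / 2) * jap v ^ (1 + γ)) * (g w * jap w ^ (1 + γ)) := by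
      refine norm_integral_le_of_norm_le (hint.const_mul _) (Filter.Eventually.of_forall fun w => ?_)
      rw [aux_norm γ g hg]
      have h2 : ‖v - w‖ ^ (1 + γ) ≤ (Real.sqrt 2 * (jap v * jap w)) ^ (1 + γ) :=
        Real.rpow_le_rpow (norm_nonneg _) (aux_jap v w) (by linarith)
      rw [Real.mul_rpow (Real.sqrt_nonneg _) (mul_nonneg (hj v) (hj w)),
        Real.mul_rpow (hj v) (hj w), Real.sqrt_eq_rpow, ← Real.rpow_mul (by norm_num)] at h2
      have h3 := mul_le_mul_of_nonneg_right ((aux_le γ v w).trans h2) (hg w)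
      refine h3.trans (le_of_eq ?_)
      rw [show 1 / 2 * (1 + γ) = (1 + γ) / 2 by ring]
      ring
    rw [integral_const_mul] at key
    rw [norm_bfield, show (3 + γ) / 2 = 1 + (1 + γ) / 2 by ring, Real.rpow_add (by norm_num),
      Real.rpow_one]
    linarith
  · intro h1
    set K : ℝ := (∫ x : E3, ker (1 + γ) x ^ 2) ^ ((1 : ℝ) / 2) with hK
    have hK0 : 0 ≤ K := Real.rpow_nonneg (integral_nonneg fun x => sq_nonneg _) _
    refine ⟨2 * (1 + K), by positivity, ?_⟩
    intro g hgm hg hint hint2 v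
    set k : E3 → ℝ := fun w => ker (1 + γ) (v - w) with hk
    have hkm : Measurable k := (ker_meas _).comp (by fun_prop)
    have hk2 : Integrable (fun w => k w ^ 2) :=
      (ker_sq (1 + γ) (by linarith)).comp_sub_left v
    have mk : MemLp k 2 := (memLp_two_iff_integrable_sq hkm.aestronglyMeasurable).2 hk2
    have mg : MemLp g 2 := (memLp_two_iff_integrable_sq hgm.aestronglyMeasurable).2 hint2
    have hkg : Integrable (fun w => k w * g w) := mk.integrable_mul mg
    have hCS : ∫ w, k w * g w ≤ K * (∫ w, (g w) ^ 2) ^ ((1 : ℝ) / 2) := by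
      have := integral_mul_le_Lp_mul_Lq_of_nonneg (μ := volume) (p := 2) (q := 2)
        Real.HolderConjugate.two_two
        (Filter.Eventually.of_forall fun w => ker_nonneg _ _ : 0 ≤ᵐ[volume] k)
        (Filter.Eventually.of_forall hg) (by simpa using mk) (by simpa using mg)
      simp only [Real.rpow_two] at this
      have e : ∫ w, k w ^ 2 = ∫ x : E3, ker (1 + γ) x ^ 2 :=
        integral_sub_left_eq_self (fun x : E3 => ker (1 + γ) x ^ 2) volume v
      rwa [e] at this
    have key : ‖∫ w, (‖v - w‖ ^ γ * g w) • (v - w)‖ ≤ ∫ w, (g w + k w * g w) := by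
      refine norm_integral_le_of_norm_le (hint.add hkg) (Filter.Eventually.of_forall fun w => ?_)
      rw [aux_norm γ g hg]
      have h3 := mul_le_mul_of_nonneg_right
        ((aux_le γ v w).trans (le_ker (1 + γ) (by linarith) (v - w))) (hg w)
      refine h3.trans (le_of_eq ?_)
      simp only [hk]; ring
    rw [integral_add hint hkg] at key
    rw [norm_bfield]
    have a0 : 0 ≤ ∫ w, g w := integral_nonneg hg
    have b0 : 0 ≤ (∫ w, (g w) ^ 2) ^ ((1 : ℝ) / 2) :=
      Real.rpow_nonneg (integral_nonneg fun x => sq_nonneg _) _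
    nlinarith [mul_nonneg hK0 a0]
end
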